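/- Let f : ℝ^m → ℝ be differentiable with L_eq-Lipschitz gradient (L_eq > 0), bounded below by c ∈ ℝ, and let 0 < γ ≤ 1/L_eq. Then the gradient descent iterates x_{n+1} = x_n − γ∇f(x_n) satisfy the summability bound (γ/2) Σ_{n=0}^{∞} ‖∇f(x_n)‖² ≤ f(x_0) − c; in particular ‖∇f(x_n)‖ → 0 as n → ∞. -/

import Mathlib

open Filter Topology

section Descent

variable {E : Type*} [NormedAddCommGroup E] [InnerProductSpace ℝ E] [CompleteSpace E]
  {f : E → ℝ} {L : ℝ}

/-- The descent lemma: a function with `L`-Lipschitz gradient lies below its quadratic upper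
model at every point. -/
theorem le_add_inner_gradient_add_sq (hf : Differentiable ℝ f)
    (hlip : ∀ x y, ‖gradient f x - gradient f y‖ ≤ L * ‖x - y‖) (x v : E) :
    f (x + v) ≤ f x + inner ℝ (gradient f x) v + L / 2 * ‖v‖ ^ 2 := by
  have hline (t : ℝ) : HasDerivAt (fun s : ℝ => f (x + s • v))
      (inner ℝ (gradient f (x + t • v)) v) t := by
    have hpath : HasDerivAt (fun s : ℝ => x + s • v) v t := by
      simpa using ((hasDerivAt_id t).smul_const v).const_add x
    simpa [Function.comp_def] using (hf _).hasGradientAt.hasFDerivAt.comp_hasDerivAt t hpath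
  have hmodel (t : ℝ) : HasDerivAt
      (fun s : ℝ => f x + s * inner ℝ (gradient f x) v + L / 2 * ‖v‖ ^ 2 * s ^ 2)
      (inner ℝ (gradient f x) v + L * ‖v‖ ^ 2 * t) t := by
    refine ((((hasDerivAt_id t).mul_const (inner ℝ (gradient f x) v)).const_add (f x)).add
      ((hasDerivAt_pow 2 t).const_mul (L / 2 * ‖v‖ ^ 2))).congr_deriv ?_
    norm_num
    ring
  have key := image_le_of_deriv_right_le_deriv_boundary (a := 0) (b := 1)
    (fun t _ => (hline t).continuousAt.continuousWithinAt)
    (fun t _ => (hline t).hasDerivWithinAt) (by simp)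
    (fun t _ => (hmodel t).continuousAt.continuousWithinAt)
    (fun t _ => (hmodel t).hasDerivWithinAt) ?_
    (Set.right_mem_Icc.2 zero_le_one)
  · simpa using key
  · intro t ht
    have hcs := real_inner_le_norm (gradient f (x + t • v) - gradient f x) v
    have hg := hlip (x + t • v) x
    rw [add_sub_cancel_left, norm_smul, Real.norm_of_nonneg ht.1] at hg
    rw [inner_sub_left] at hcs
    have := mul_le_mul_of_nonneg_right hg (norm_nonneg v)
    linarith

/-- A gradient step of size at most `1 / L` decreases the objective sufficiently. -/
theorem sufficient_decrease_gradient_step (hf : Differentiable ℝ f)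
    (hlip : ∀ x y, ‖gradient f x - gradient f y‖ ≤ L * ‖x - y‖) (hL : 0 < L)
    {γ : ℝ} (hγ0 : 0 < γ) (hγ : γ ≤ 1 / L) (x : E) :
    γ / 2 * ‖gradient f x‖ ^ 2 ≤ f x - f (x - γ • gradient f x) := by
  have h := le_add_inner_gradient_add_sq hf hlip x (-(γ • gradient f x))
  rw [← sub_eq_add_neg, inner_neg_right, real_inner_smul_right, real_inner_self_eq_norm_sq,
    norm_neg, norm_smul, Real.norm_of_nonneg hγ0.le] at h
  have hγL : γ * L ≤ 1 := (le_div_iff₀ hL).1 hγ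
  have := mul_le_mul_of_nonneg_right hγL
    (mul_nonneg hγ0.le (sq_nonneg ‖gradient f x‖))
  linarith

end Descent

/-- If `f` is differentiable with `L_eq`-Lipschitz gradient, bounded below by `c`,
and `0 < γ ≤ 1/L_eq`, then the gradient descent iterates satisfy the summability
bound `(γ/2) Σₙ ‖∇f(xₙ)‖² ≤ f(x₀) − c`; in particular `‖∇f(xₙ)‖ → 0`. -/
theorem epnp_gradient_summability {m : ℕ} (f : EuclideanSpace ℝ (Fin m) → ℝ)
    (hf : Differentiable ℝ f) (L_eq : ℝ) (hL : 0 < L_eq)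
    (hlip : ∀ x y, ‖gradient f x - gradient f y‖ ≤ L_eq * ‖x - y‖)
    (c : ℝ) (hbdd : ∀ x, c ≤ f x)
    (γ : ℝ) (hγ0 : 0 < γ) (hγ : γ ≤ 1 / L_eq)
    (x : ℕ → EuclideanSpace ℝ (Fin m))
    (hx : ∀ n, x (n + 1) = x n - γ • gradient f (x n)) :
    Summable (fun n => ‖gradient f (x n)‖ ^ 2) ∧
    (γ / 2) * ∑' n : ℕ, ‖gradient f (x n)‖ ^ 2 ≤ f (x 0) - c ∧
    Tendsto (fun n => ‖gradient f (x n)‖) atTop (𝓝 0) := by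
  have hpartial (N : ℕ) :
      ∑ n ∈ Finset.range N, ‖gradient f (x n)‖ ^ 2 ≤ (f (x 0) - c) / (γ / 2) := by
    rw [le_div_iff₀' (half_pos hγ0), Finset.mul_sum]
    calc ∑ n ∈ Finset.range N, γ / 2 * ‖gradient f (x n)‖ ^ 2
        ≤ ∑ n ∈ Finset.range N, (f (x n) - f (x (n + 1))) :=
          Finset.sum_le_sum fun n _ => by
            rw [hx n]
            exact sufficient_decrease_gradient_step hf hlip hL hγ0 hγ (x n)
      _ = f (x 0) - f (x N) := Finset.sum_range_sub' (fun n => f (x n)) N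
      _ ≤ f (x 0) - c := sub_le_sub_left (hbdd _) _
  have hsum : Summable fun n => ‖gradient f (x n)‖ ^ 2 :=
    summable_of_sum_range_le (fun _ => sq_nonneg _) hpartial
  refine ⟨hsum, ?_, ?_⟩
  · rw [← le_div_iff₀' (half_pos hγ0)]
    exact Real.tsum_le_of_sum_range_le (fun _ => sq_nonneg _) hpartial
  · simpa [Real.sqrt_sq] using hsum.tendsto_atTop_zero.sqrt
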